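/- Let p be a prime and n ≥ 1 an integer. Let A be a nonzero Artinian local commutative ring in which p ≠ 0 and whose residue field κ is a perfect field of characteristic p. Then there is no natural family (F_B) of group homomorphisms F_B : Sp_{2n}(B) → Sp_{2n}(B), indexed by commutative A-algebras B, such that for every commutative A-algebra B on which the structure map kills the maximal ideal of A (i.e. B is a κ-algebra), the map F_B is the entrywise Frobenius. In other words, the Frobenius homomorphism of the symplectic group Sp_{2n} admits no deformation over any such A. -/

import Mathlib

universe u

open Matrix

namespace NoDefFrob

/-- The torus element `diag(a, …, a, b, …, b)` with `a * b = 1`. -/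
def hT (n : ℕ) {B : Type u} [CommRing B] (a b : B) (h : a * b = 1) :
    symplecticGroup (Fin n) B :=
  ⟨fromBlocks (diagonal fun _ => a) 0 0 (diagonal fun _ => b), by
    have h' : b * a = 1 := by rw [mul_comm, h]
    rw [SymplecticGroup.mem_iff, J, fromBlocks_transpose, fromBlocks_multiply,
      fromBlocks_multiply]
    simp [h, h', ← diagonal_one, diagonal_neg]⟩

/-- The unipotent element `[[1, x], [0, 1]]`. -/
def uX (n : ℕ) {B : Type u} [CommRing B] (x : B) : symplecticGroup (Fin n) B :=
  ⟨fromBlocks 1 (diagonal fun _ => x) 0 1, by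
    rw [SymplecticGroup.mem_iff, J, fromBlocks_transpose, fromBlocks_multiply,
      fromBlocks_multiply]
    simp⟩

lemma hT_mul (n : ℕ) {B : Type u} [CommRing B] (a b c d : B) (h : a * b = 1) (h' : c * d = 1)
    (h'' : (a * c) * (b * d) = 1) :
    hT n (a * c) (b * d) h'' = hT n a b h * hT n c d h' := by
  apply Subtype.ext
  simp [hT, fromBlocks_multiply]

lemma hT_one (n : ℕ) {B : Type u} [CommRing B] (h : (1 : B) * 1 = 1) : hT n (1 : B) 1 h = 1 := by
  apply Subtype.ext
  simp [hT]

lemma uX_zero (n : ℕ) {B : Type u} [CommRing B] : uX n (0 : B) = 1 := by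
  apply Subtype.ext
  simp [uX]

lemma uX_add (n : ℕ) {B : Type u} [CommRing B] (x y : B) :
    uX n (x + y) = uX n x * uX n y := by
  apply Subtype.ext
  simp [uX, fromBlocks_multiply, add_comm]

lemma hT_uX (n : ℕ) {B : Type u} [CommRing B] (a b x : B) (h : a * b = 1) :
    uX n (a ^ 2 * x) * hT n a b h = hT n a b h * uX n x := by
  have : a ^ 2 * x * b = a * x := by linear_combination (a * x) * h
  apply Subtype.ext
  simp only [uX, hT, Submonoid.coe_mul, fromBlocks_multiply]
  simp [this]

open AddMonoidAlgebra

section coeffs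
variable {A : Type u} [CommRing A]

/-- first variable -/
noncomputable def i1 : AddMonoidAlgebra A ℤ →ₐ[A] AddMonoidAlgebra A (ℤ × ℤ) :=
  AddMonoidAlgebra.mapDomainAlgHom A A (AddMonoidHom.inl ℤ ℤ)
/-- second variable -/
noncomputable def i2 : AddMonoidAlgebra A ℤ →ₐ[A] AddMonoidAlgebra A (ℤ × ℤ) :=
  AddMonoidAlgebra.mapDomainAlgHom A A (AddMonoidHom.inr ℤ ℤ)
/-- product of the variables -/
noncomputable def i3 : AddMonoidAlgebra A ℤ →ₐ[A] AddMonoidAlgebra A (ℤ × ℤ) :=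
  AddMonoidAlgebra.mapDomainAlgHom A A ((AddMonoidHom.id ℤ).prod (AddMonoidHom.id ℤ))

@[simp] lemma i1_single (k : ℤ) (a : A) : i1 (single k a) = single (k, 0) a := by simp [-LaurentPolynomial.single_eq_C_mul_T, i1]
@[simp] lemma i2_single (k : ℤ) (a : A) : i2 (single k a) = single (0, k) a := by simp [-LaurentPolynomial.single_eq_C_mul_T, i2]
@[simp] lemma i3_single (k : ℤ) (a : A) : i3 (single k a) = single (k, k) a := by simp [-LaurentPolynomial.single_eq_C_mul_T, i3]

lemma coeff_i1_i2 (f g : AddMonoidAlgebra A ℤ) (k l : ℤ) :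
    (i1 f * i2 g).coeff (k, l) = f.coeff k * g.coeff l := by
  induction f using AddMonoidAlgebra.induction_linear with
  | zero => simp [-LaurentPolynomial.single_eq_C_mul_T]
  | add f f' hf hf' => simp [-LaurentPolynomial.single_eq_C_mul_T, add_mul, hf, hf']
  | single m a =>
    induction g using AddMonoidAlgebra.induction_linear with
    | zero => simp [-LaurentPolynomial.single_eq_C_mul_T]
    | add f f' hf hf' => simp only [map_add, mul_add, AddMonoidAlgebra.coeff_add, Finsupp.add_apply, hf, hf']
    | single m' a' =>
      simp [-LaurentPolynomial.single_eq_C_mul_T, single_mul_single, Finsupp.single_apply, Prod.ext_iff]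
      split_ifs <;> simp_all [-LaurentPolynomial.single_eq_C_mul_T]

lemma coeff_i3 (f : AddMonoidAlgebra A ℤ) (k l : ℤ) :
    (i3 f).coeff (k, l) = if k = l then f.coeff k else 0 := by
  induction f using AddMonoidAlgebra.induction_linear with
  | zero => simp [-LaurentPolynomial.single_eq_C_mul_T]
  | add f f' hf hf' => simp only [map_add, coeff_add, Finsupp.add_apply, hf, hf']; split_ifs <;> simp [-LaurentPolynomial.single_eq_C_mul_T]
  | single m a =>
    simp only [i3_single, coeff_single, Finsupp.single_apply, Prod.ext_iff]
    split_ifs <;> first | rfl | omega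

open Polynomial in
lemma coeff_q1 (q : Polynomial A) (f : AddMonoidAlgebra A ℤ) (m : ℤ) (l : ℕ) :
    (aeval (single ((2 : ℤ), (1 : ℤ)) (1 : A)) q * i1 f).coeff (m, (l : ℤ))
      = q.coeff l * f.coeff (m - 2 * l) := by
  induction f using AddMonoidAlgebra.induction_linear with
  | zero => simp [-LaurentPolynomial.single_eq_C_mul_T]
  | add f f' hf hf' => simp only [map_add, mul_add, AddMonoidAlgebra.coeff_add, Finsupp.add_apply, hf, hf']
  | single m' a =>
    induction q using Polynomial.induction_on' with
    | add f f' hf hf' =>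
      simp only [map_add, add_mul, AddMonoidAlgebra.coeff_add, Finsupp.add_apply, hf, hf',
        Polynomial.coeff_add]
    | monomial k b =>
      simp only [aeval_monomial, single_pow, i1_single, AddMonoidAlgebra.coe_algebraMap,
        Function.comp, Algebra.algebraMap_self, RingHom.id_apply, single_mul_single,
        coeff_single, Finsupp.single_apply, Prod.ext_iff, Polynomial.coeff_monomial]
      simp [-LaurentPolynomial.single_eq_C_mul_T]
      split_ifs <;> first | rfl | omega

open Polynomial in
lemma coeff_q2 (q : Polynomial A) (f : AddMonoidAlgebra A ℤ) (m : ℤ) (l : ℕ) :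
    (i1 f * aeval (single ((0 : ℤ), (1 : ℤ)) (1 : A)) q).coeff (m, (l : ℤ))
      = f.coeff m * q.coeff l := by
  induction f using AddMonoidAlgebra.induction_linear with
  | zero => simp [-LaurentPolynomial.single_eq_C_mul_T]
  | add f f' hf hf' => simp only [map_add, add_mul, AddMonoidAlgebra.coeff_add, Finsupp.add_apply, hf, hf']
  | single m' a =>
    induction q using Polynomial.induction_on' with
    | add f f' hf hf' =>
      simp only [map_add, mul_add, AddMonoidAlgebra.coeff_add, Finsupp.add_apply, hf, hf',
        Polynomial.coeff_add]
    | monomial k b =>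
      simp only [aeval_monomial, single_pow, i1_single, AddMonoidAlgebra.coe_algebraMap,
        Function.comp, Algebra.algebraMap_self, RingHom.id_apply, single_mul_single,
        coeff_single, Finsupp.single_apply, Prod.ext_iff, Polynomial.coeff_monomial]
      simp [-LaurentPolynomial.single_eq_C_mul_T]
      split_ifs <;> simp_all [-LaurentPolynomial.single_eq_C_mul_T] <;> omega

end coeffs

lemma idem_zero {A : Type u} [CommRing A] [IsArtinianRing A] [IsLocalRing A] {ι : Type*}
    [Fintype ι] (P : Matrix ι ι A) (hP : P * P = P)
    (hm : ∀ i j, P i j ∈ IsLocalRing.maximalIdeal A) : P = 0 := by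
  have key : ∀ r : ℕ, ∀ i j, P i j ∈ IsLocalRing.maximalIdeal A ^ r := by
    intro r
    induction r with
    | zero => simp [-LaurentPolynomial.single_eq_C_mul_T]
    | succ r ih =>
      intro i j
      rw [← hP, Matrix.mul_apply, pow_succ]
      exact Ideal.sum_mem _ fun k _ => Ideal.mul_mem_mul (ih i k) (hm k j)
  obtain ⟨r, hr⟩ := IsArtinianRing.isNilpotent_jacobson_bot (R := A)
  rw [IsLocalRing.jacobson_eq_maximalIdeal ⊥ bot_ne_top] at hr
  ext i j
  have := key r i j
  rw [hr] at this
  simpa [-LaurentPolynomial.single_eq_C_mul_T] using this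

end NoDefFrob

open NoDefFrob

/-- Let `p` be a prime and `n ≥ 1`.  Let `A` be a nonzero Artinian local commutative ring with
`p ≠ 0` in `A`, whose residue field `κ` is a perfect field of characteristic `p`.  Then there is
no natural family of group homomorphisms `F_B : Sp_{2n}(B) → Sp_{2n}(B)`, indexed by commutative
`A`-algebras `B` (naturality being expressed entrywise: whenever `M'` is the entrywise image of
`M` under an `A`-algebra map `f : B → B'`, then `F_{B'} M'` is the entrywise image of `F_B M`),
restricting to the entrywise Frobenius on every `κ`-algebra `B` (i.e. every `B` on which the
structure map kills the maximal ideal of `A`): the Frobenius homomorphism of the symplectic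
group `Sp_{2n}` admits no deformation over `A`. -/
theorem no_deformation_of_frobenius_Sp
    (p n : ℕ) [Fact p.Prime] (hn : 1 ≤ n)
    (A : Type u) [CommRing A] [IsArtinianRing A] [IsLocalRing A] [Nontrivial A]
    (hpA : (p : A) ≠ 0)
    [CharP (IsLocalRing.ResidueField A) p]
    [PerfectField (IsLocalRing.ResidueField A)] :
    ¬ ∃ F : ∀ (B : Type u) [CommRing B] [Algebra A B],
        symplecticGroup (Fin n) B →* symplecticGroup (Fin n) B,
      (∀ (B B' : Type u) [CommRing B] [CommRing B'] [Algebra A B] [Algebra A B']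
          (f : B →ₐ[A] B')
          (M : symplecticGroup (Fin n) B) (M' : symplecticGroup (Fin n) B'),
          (∀ i j : Fin n ⊕ Fin n,
              (M' : Matrix (Fin n ⊕ Fin n) (Fin n ⊕ Fin n) B') i j
                = f ((M : Matrix (Fin n ⊕ Fin n) (Fin n ⊕ Fin n) B) i j)) →
          ∀ i j : Fin n ⊕ Fin n,
            (F B' M' : Matrix (Fin n ⊕ Fin n) (Fin n ⊕ Fin n) B') i j
              = f ((F B M : Matrix (Fin n ⊕ Fin n) (Fin n ⊕ Fin n) B) i j)) ∧
      (∀ (B : Type u) [CommRing B] [Algebra A B],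
          (∀ a ∈ IsLocalRing.maximalIdeal A, algebraMap A B a = 0) →
          ∀ (M : symplecticGroup (Fin n) B) (i j : Fin n ⊕ Fin n),
            (F B M : Matrix (Fin n ⊕ Fin n) (Fin n ⊕ Fin n) B) i j
              = ((M : Matrix (Fin n ⊕ Fin n) (Fin n ⊕ Fin n) B) i j) ^ p) := by
  rintro ⟨F, hnat, hfrob⟩
  have hp : p.Prime := Fact.out
  have hp0 : 0 < p := hp.pos
  have hp2 : 2 ≤ p := hp.two_le
  -- naturality for the torus and for the unipotent
  have natT : ∀ (B B' : Type u) [CommRing B] [CommRing B'] [Algebra A B] [Algebra A B']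
      (f : B →ₐ[A] B') (a b : B) (h : a * b = 1) (a' b' : B') (h' : a' * b' = 1),
      f a = a' → f b = b' → ((F B' (hT n a' b' h') : symplecticGroup (Fin n) B') :
        Matrix (Fin n ⊕ Fin n) (Fin n ⊕ Fin n) B')
        = (F B (hT n a b h) : Matrix (Fin n ⊕ Fin n) (Fin n ⊕ Fin n) B).map f := by
    intro B B' _ _ _ _ f a b h a' b' h' ha hb
    ext i j
    rw [Matrix.map_apply]
    refine hnat B B' f _ _ ?_ i j
    rintro (i | i) (j | j) <;> simp [-LaurentPolynomial.single_eq_C_mul_T, hT, diagonal_apply, apply_ite f, ha, hb]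
  have natU : ∀ (B B' : Type u) [CommRing B] [CommRing B'] [Algebra A B] [Algebra A B']
      (f : B →ₐ[A] B') (a : B) (a' : B'),
      f a = a' → ((F B' (uX n a') : symplecticGroup (Fin n) B') :
        Matrix (Fin n ⊕ Fin n) (Fin n ⊕ Fin n) B')
        = (F B (uX n a) : Matrix (Fin n ⊕ Fin n) (Fin n ⊕ Fin n) B).map f := by
    intro B B' _ _ _ _ f a a' ha
    ext i j
    rw [Matrix.map_apply]
    refine hnat B B' f _ _ ?_ i j
    rintro (i | i) (j | j) <;> simp [-LaurentPolynomial.single_eq_C_mul_T, uX, diagonal_apply, Matrix.one_apply, apply_ite f, ha]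
  have hTT : ∀ (S : Type u) [CommRing S],
      (AddMonoidAlgebra.single (1 : ℤ) (1 : S)) * AddMonoidAlgebra.single (-1 : ℤ) (1 : S) = 1 := by
    intro S _
    rw [AddMonoidAlgebra.single_mul_single]; simp [-LaurentPolynomial.single_eq_C_mul_T, AddMonoidAlgebra.one_def, Prod.zero_eq_mk]
  set M : Matrix (Fin n ⊕ Fin n) (Fin n ⊕ Fin n) (AddMonoidAlgebra A ℤ) :=
    (F (AddMonoidAlgebra A ℤ) (hT n _ _ (hTT A))).1 with hM
  set V : Matrix (Fin n ⊕ Fin n) (Fin n ⊕ Fin n) (Polynomial A) :=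
    (F (Polynomial A) (uX n Polynomial.X)).1 with hV
  let P : ℤ → Matrix (Fin n ⊕ Fin n) (Fin n ⊕ Fin n) A := fun k => M.map (fun x => x.coeff k)
  let W : ℕ → Matrix (Fin n ⊕ Fin n) (Fin n ⊕ Fin n) A := fun k => V.map (fun x => x.coeff k)
  have h10 : (AddMonoidAlgebra.single ((1 : ℤ), (0 : ℤ)) (1 : A)) *
      AddMonoidAlgebra.single ((-1 : ℤ), (0 : ℤ)) (1 : A) = 1 := by
    rw [AddMonoidAlgebra.single_mul_single]; simp [-LaurentPolynomial.single_eq_C_mul_T, AddMonoidAlgebra.one_def, Prod.zero_eq_mk]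
  have h01 : (AddMonoidAlgebra.single ((0 : ℤ), (1 : ℤ)) (1 : A)) *
      AddMonoidAlgebra.single ((0 : ℤ), (-1 : ℤ)) (1 : A) = 1 := by
    rw [AddMonoidAlgebra.single_mul_single]; simp [-LaurentPolynomial.single_eq_C_mul_T, AddMonoidAlgebra.one_def, Prod.zero_eq_mk]
  -- the coefficients are orthogonal idempotents
  have hPP : ∀ k l, P k * P l = if k = l then P k else 0 := by
    intro k l
    have e1 := natT _ _ i1 _ _ (hTT A) _ _ h10 (by simp [-LaurentPolynomial.single_eq_C_mul_T]) (by simp [-LaurentPolynomial.single_eq_C_mul_T])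
    have e2 := natT _ _ i2 _ _ (hTT A) _ _ h01 (by simp [-LaurentPolynomial.single_eq_C_mul_T]) (by simp [-LaurentPolynomial.single_eq_C_mul_T])
    have e3 := natT _ _ i3 _ _ (hTT A) _ _
      (show (AddMonoidAlgebra.single ((1 : ℤ), (0 : ℤ)) (1 : A) *
        AddMonoidAlgebra.single ((0 : ℤ), (1 : ℤ)) (1 : A)) *
        (AddMonoidAlgebra.single ((-1 : ℤ), (0 : ℤ)) (1 : A) *
        AddMonoidAlgebra.single ((0 : ℤ), (-1 : ℤ)) (1 : A)) = 1 by
          rw [mul_mul_mul_comm, h10, h01, one_mul])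
      (by simp [-LaurentPolynomial.single_eq_C_mul_T, AddMonoidAlgebra.single_mul_single]) (by simp [-LaurentPolynomial.single_eq_C_mul_T, AddMonoidAlgebra.single_mul_single])
    rw [hT_mul n _ _ _ _ h10 h01, map_mul, Submonoid.coe_mul, e1, e2] at e3
    ext i j
    have e4 := congrArg (fun X => (X i j).coeff (k, l)) e3
    simp only [Matrix.mul_apply, Matrix.map_apply, coeff_i3, AddMonoidAlgebra.coeff_sum,
      Finsupp.finsetSum_apply, coeff_i1_i2] at e4
    rw [Matrix.mul_apply]
    refine Eq.trans ?_ (e4.trans ?_)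
    · rfl
    · split_ifs <;> rfl
  have hWP : ∀ (m : ℤ) (l : ℕ), W l * P (m - 2 * l) = P m * W l := by
    intro m l
    have e1 := natT _ _ i1 _ _ (hTT A) _ _ h10 (by simp [-LaurentPolynomial.single_eq_C_mul_T]) (by simp [-LaurentPolynomial.single_eq_C_mul_T])
    have e2 := natU _ _ (Polynomial.aeval (AddMonoidAlgebra.single ((0 : ℤ), (1 : ℤ)) (1 : A)))
      Polynomial.X _ (Polynomial.aeval_X _)
    have e3 := natU _ _ (Polynomial.aeval (AddMonoidAlgebra.single ((2 : ℤ), (1 : ℤ)) (1 : A)))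
      Polynomial.X _ (Polynomial.aeval_X _)
    have e4 := hT_uX n _ _ (AddMonoidAlgebra.single ((0 : ℤ), (1 : ℤ)) (1 : A)) h10
    have e5 : AddMonoidAlgebra.single ((1 : ℤ), (0 : ℤ)) (1 : A) ^ 2 *
        AddMonoidAlgebra.single ((0 : ℤ), (1 : ℤ)) (1 : A) =
        AddMonoidAlgebra.single ((2 : ℤ), (1 : ℤ)) (1 : A) := by
      rw [AddMonoidAlgebra.single_pow, AddMonoidAlgebra.single_mul_single]; simp [-LaurentPolynomial.single_eq_C_mul_T]
    rw [e5] at e4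
    have e6 := congrArg (fun X => (F _ X).1) e4
    simp only [map_mul, Submonoid.coe_mul] at e6
    rw [e1, e2, e3] at e6
    ext i j
    have e7 := congrArg (fun X => (X i j).coeff (m, (l : ℤ))) e6
    simp only [Matrix.mul_apply, Matrix.map_apply, AddMonoidAlgebra.coeff_sum,
      Finsupp.finsetSum_apply, coeff_q1, coeff_q2] at e7
    rw [Matrix.mul_apply, Matrix.mul_apply]
    exact e7
  -- reductions
  have hκ : ∀ a ∈ IsLocalRing.maximalIdeal A,
      algebraMap A (IsLocalRing.ResidueField A) a = 0 := fun a ha =>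
    (IsLocalRing.residue_eq_zero_iff a).2 ha
  have hPm : ∀ k : ℤ, k ≠ p → k ≠ -p → P k = 0 := by
    intro k hk hk'
    refine idem_zero _ (by rw [hPP, if_pos rfl]) fun i j => ?_
    have e1 := natT _ _ (AddMonoidAlgebra.mapAlgHom ℤ (Algebra.ofId A (IsLocalRing.ResidueField A)))
      _ _ (hTT A) _ _ (hTT (IsLocalRing.ResidueField A)) (by simp [-LaurentPolynomial.single_eq_C_mul_T]) (by simp [-LaurentPolynomial.single_eq_C_mul_T])
    have e2 := hfrob (AddMonoidAlgebra (IsLocalRing.ResidueField A) ℤ) (fun a ha => by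
      simpa [-LaurentPolynomial.single_eq_C_mul_T] using ha) (hT n _ _ (hTT (IsLocalRing.ResidueField A))) i j
    rw [e1, Matrix.map_apply] at e2
    have e3 := congrArg (fun x => x.coeff k) e2
    rw [← IsLocalRing.residue_eq_zero_iff]
    refine Eq.trans ?_ (e3.trans ?_)
    · simp [-LaurentPolynomial.single_eq_C_mul_T, P]; rfl
    · rcases i with i | i <;> rcases j with j | j <;>
        simp [-LaurentPolynomial.single_eq_C_mul_T, hT, diagonal_apply, hp.ne_zero, ite_pow, AddMonoidAlgebra.single_pow] <;>
        split_ifs <;> simp [-LaurentPolynomial.single_eq_C_mul_T, Finsupp.single_apply] <;> omega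
  have hW1 : W p (Sum.inl ⟨0, hn⟩) (Sum.inr ⟨0, hn⟩) ∉ IsLocalRing.maximalIdeal A := by
    have e1 := natU _ _ (Polynomial.mapAlgHom (Algebra.ofId A (IsLocalRing.ResidueField A)))
      Polynomial.X Polynomial.X (by simp [-LaurentPolynomial.single_eq_C_mul_T])
    have e2 := hfrob (Polynomial (IsLocalRing.ResidueField A)) (fun a ha => by
      simpa [Polynomial.algebraMap_apply] using ha) (uX n Polynomial.X) (Sum.inl ⟨0, hn⟩) (Sum.inr ⟨0, hn⟩)
    rw [e1, Matrix.map_apply] at e2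
    have e3 := congrArg (fun x => x.coeff p) e2
    rw [← IsLocalRing.residue_eq_zero_iff]
    have e4 : IsLocalRing.residue A (W p (Sum.inl ⟨0, hn⟩) (Sum.inr ⟨0, hn⟩)) = 1 := by
      refine Eq.trans ?_ (e3.trans ?_)
      · simp [-LaurentPolynomial.single_eq_C_mul_T, W]; rfl
      · simp [-LaurentPolynomial.single_eq_C_mul_T, uX]
    rw [e4]
    exact one_ne_zero
  have hPQ : P p + P (-p) = 1 := by
    have e1 := natT _ _ (AddMonoidAlgebra.lift A A ℤ 1) _ _ (hTT A) (1 : A) 1 (one_mul 1)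
      (by simp [-LaurentPolynomial.single_eq_C_mul_T]) (by simp [-LaurentPolynomial.single_eq_C_mul_T])
    rw [hT_one, map_one, Submonoid.coe_one] at e1
    rw [e1]
    ext i j
    have e2 : M i j = AddMonoidAlgebra.single (p : ℤ) (P p i j) +
        AddMonoidAlgebra.single (-p : ℤ) (P (-p) i j) := by
      ext k
      simp only [AddMonoidAlgebra.coeff_add, AddMonoidAlgebra.coeff_single, Finsupp.add_apply,
        Finsupp.single_apply]
      by_cases h1 : (p : ℤ) = k
      · have : ¬ (-p : ℤ) = k := by omega
        rw [if_pos h1, if_neg this, ← h1, add_zero]; rfl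
      · by_cases h2 : (-p : ℤ) = k
        · rw [if_neg h1, if_pos h2, ← h2, zero_add]; rfl
        · rw [if_neg h1, if_neg h2, add_zero]
          exact congrFun (congrFun (hPm k (Ne.symm h1) (Ne.symm h2)) i) j
    rw [Matrix.map_apply, ← hM, e2]
    simp [-LaurentPolynomial.single_eq_C_mul_T]
  -- structure of `W`
  have hWP1 : ∀ l : ℕ, 0 < l → W l * P p = 0 := by
    intro l hl
    have := hWP (p + 2 * l) l
    rw [add_sub_cancel_right, hPm (p + 2 * l) (by omega) (by omega), zero_mul] at this
    exact this
  have hW0 : ∀ l : ℕ, l ≠ 0 → l ≠ p → W l = 0 := by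
    intro l hl hl'
    have := hWP (-p + 2 * l) l
    rw [add_sub_cancel_right, hPm (-p + 2 * l) (by omega) (by omega), zero_mul] at this
    rw [← mul_one (W l), ← hPQ, mul_add, hWP1 l (by omega), this, add_zero]
  have hWW : W p * W p = 0 := by
    have h1 := hWP p p
    have h2 : (p : ℤ) - 2 * p = -p := by ring
    rw [h2] at h1
    have h3 : W p = P p * W p := by
      rw [← h1]
      conv_lhs => rw [← mul_one (W p), ← hPQ, mul_add, hWP1 p hp0, zero_add]
    calc W p * W p = W p * (P p * W p) := by rw [← h3]
      _ = 0 := by rw [← mul_assoc, hWP1 p hp0, zero_mul]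
  have hVij : ∀ i j, V i j = Polynomial.C (W 0 i j) + Polynomial.C (W p i j) * Polynomial.X ^ p := by
    intro i j
    ext l
    rw [Polynomial.coeff_add, Polynomial.coeff_C, Polynomial.coeff_C_mul_X_pow]
    by_cases h1 : l = 0
    · subst h1; rw [if_pos rfl, if_neg (by omega), add_zero]; rfl
    · by_cases h2 : l = p
      · subst h2; rw [if_neg h1, if_pos rfl, zero_add]; rfl
      · rw [if_neg h1, if_neg h2, add_zero]
        exact congrFun (congrFun (hW0 l h1 h2) i) j
  have hW01 : W 0 = 1 := by
    have e1 := natU _ _ (Polynomial.aeval (0 : A)) Polynomial.X (0 : A) (by simp [-LaurentPolynomial.single_eq_C_mul_T])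
    rw [uX_zero, map_one, Submonoid.coe_one] at e1
    rw [e1]
    ext i j
    rw [Matrix.map_apply, ← hV, hVij]
    simp [-LaurentPolynomial.single_eq_C_mul_T, hp.ne_zero]
  have hU : ∀ b : Polynomial A, (F (Polynomial A) (uX n b)).1 =
      1 + (b ^ p) • (W p).map Polynomial.C := by
    intro b
    have e1 := natU _ _ (Polynomial.aeval b) Polynomial.X b (by simp [-LaurentPolynomial.single_eq_C_mul_T])
    rw [e1]
    ext1 i j
    rw [Matrix.map_apply, ← hV, hVij, hW01]
    rw [Matrix.add_apply, Matrix.smul_apply, Matrix.map_apply, Matrix.one_apply, Matrix.one_apply,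
      map_add, map_mul, map_pow, Polynomial.aeval_X, Polynomial.aeval_C, Polynomial.aeval_C,
      smul_eq_mul, mul_comm (b ^ p)]
    split_ifs <;> simp [-LaurentPolynomial.single_eq_C_mul_T]
  have hadd := congrArg (fun X => (F (Polynomial A) X).1) (uX_add n (Polynomial.X : Polynomial A) 1)
  simp only [map_mul, Submonoid.coe_mul, hU] at hadd
  have hWW' : (W p).map Polynomial.C * (W p).map Polynomial.C = 0 := by
    rw [← Matrix.map_mul, hWW]; simp [-LaurentPolynomial.single_eq_C_mul_T]
  simp only [mul_add, add_mul, one_mul, mul_one, Matrix.smul_mul, Matrix.mul_smul, hWW', smul_zero,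
    add_zero, add_assoc, add_right_inj, one_pow, one_smul] at hadd
  have h1 := congrArg (fun X => (X (Sum.inl ⟨0, hn⟩) (Sum.inr ⟨0, hn⟩)).coeff 1) hadd
  have hp1 : (1 : ℕ) ≠ p := by omega
  simp [-LaurentPolynomial.single_eq_C_mul_T, Polynomial.coeff_X_add_one_pow, Polynomial.coeff_X_pow, Polynomial.coeff_C, hp1] at h1
  have hunit : IsUnit (W p (Sum.inl ⟨0, hn⟩) (Sum.inr ⟨0, hn⟩)) := by
    by_contra hcon
    exact hW1 ((IsLocalRing.mem_maximalIdeal _).2 hcon)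
  exact hpA ((hunit.mul_left_eq_zero).1 h1)
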